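/- Let F be a family of at most 5 closed line-segments in ℝ², each nondegenerate, with pairwise disjoint relative interiors (i.e. the open segments are pairwise disjoint), and let M ⊆ ℝ² be a set with ⋃F ⊆ M and M \ ⋃F finite. If no affine line meets M in exactly two points, then M is collinear. -/

import Mathlib

/-- An affine line: an affine subspace whose direction is one-dimensional. -/
def IsLine (L : AffineSubspace ℝ (EuclideanSpace ℝ (Fin 2))) : Prop :=
  Module.finrank ℝ L.direction = 1

namespace SegSG

/-- The Euclidean plane. -/
abbrev Pl := EuclideanSpace ℝ (Fin 2)

/-- Affine real functions on the plane. -/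
def Aff (f : Pl → ℝ) : Prop :=
  ∀ (x y : Pl) (t : ℝ), f (x + t • (y - x)) = f x + t * (f y - f x)

/-- Every two points of `M` are collinear with a third one. -/
def Third (M : Set Pl) : Prop :=
  ∀ p ∈ M, ∀ q ∈ M, p ≠ q → ∃ r ∈ M, r ≠ p ∧ r ≠ q ∧ ∃ t : ℝ, r = p + t • (q - p)

/-- The cross product of `q - p` and `r - p`. -/
def cr (p q r : Pl) : ℝ := (q 0 - p 0) * (r 1 - p 1) - (q 1 - p 1) * (r 0 - p 0)

lemma third_of_hline (M : Set Pl)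
    (hline : ∀ L : AffineSubspace ℝ Pl, IsLine L →
      ¬ ∃ p q, p ≠ q ∧ (L : Set Pl) ∩ M = {p, q}) : Third M := by
  intro p hp q hq hpq
  by_contra hcon
  push Not at hcon
  refine hline (affineSpan ℝ {p, q}) ?_ ⟨p, q, hpq, ?_⟩
  · unfold IsLine
    rw [direction_affineSpan, vectorSpan_pair, vsub_eq_sub]
    exact finrank_span_singleton (sub_ne_zero.2 hpq)
  · ext r
    simp only [Set.mem_inter_iff, SetLike.mem_coe, Set.mem_insert_iff, Set.mem_singleton_iff]
    constructor
    · rintro ⟨h1, h2⟩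
      by_contra h3
      push Not at h3
      obtain ⟨t, ht⟩ := (mem_affineSpan_pair_iff_exists_lineMap_eq).1 h1
      refine hcon r h2 h3.1 h3.2 t ?_
      rw [← ht, AffineMap.lineMap_apply]
      simp [add_comm]
    · rintro (rfl | rfl)
      · exact ⟨left_mem_affineSpan_pair ℝ _ _, hp⟩
      · exact ⟨right_mem_affineSpan_pair ℝ _ _, hq⟩

lemma pl_ext {x y : Pl} (h0 : x 0 = y 0) (h1 : x 1 = y 1) : x = y := by
  ext i; fin_cases i <;> simpa

lemma par {d e : Pl} (hd : d ≠ 0) (h : d 0 * e 1 - d 1 * e 0 = 0) : ∃ t : ℝ, e = t • d := by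
  by_cases h0 : d 0 = 0
  · have h1 : d 1 ≠ 0 := fun h1 => hd (pl_ext (by simpa using h0) (by simpa using h1))
    refine ⟨e 1 / d 1, pl_ext ?_ ?_⟩
    · have : e 0 = 0 := by
        rw [h0] at h; simpa [h1] using h
      simp [this, h0]
    · simp; field_simp
  · refine ⟨e 0 / d 0, pl_ext ?_ ?_⟩
    · simp; field_simp
    · simp; field_simp; linarith

lemma par' {p q r : Pl} (hpq : p ≠ q) (h : cr p q r = 0) : ∃ t : ℝ, r = p + t • (q - p) := by
  obtain ⟨t, ht⟩ := par (d := q - p) (e := r - p) (sub_ne_zero.2 hpq.symm)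
    (by simpa [cr] using h)
  exact ⟨t, by rw [← ht]; abel⟩

lemma collinear_of_cr (M : Set Pl) (h : ∀ p ∈ M, ∀ q ∈ M, ∀ r ∈ M, cr p q r = 0) :
    Collinear ℝ M := by
  by_cases hM : ∃ p ∈ M, ∃ q ∈ M, p ≠ q
  · obtain ⟨p, hp, q, hq, hpq⟩ := hM
    rw [collinear_iff_of_mem hp]
    refine ⟨q - p, fun r hr => ?_⟩
    obtain ⟨t, ht⟩ := par' hpq (h p hp q hq r hr)
    exact ⟨t, by rw [ht, vadd_eq_add, add_comm]⟩
  · push Not at hM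
    have hs : M.Subsingleton := fun p hp q hq => hM p hp q hq
    rcases hs.eq_empty_or_singleton with h | ⟨p, h⟩
    · rw [h]; exact collinear_empty ℝ _
    · rw [h]; exact collinear_singleton ℝ _

lemma aff_cr (p q : Pl) : Aff (fun x => cr p q x) := by
  intro x y t; simp [cr]; ring

lemma Aff.seg {f : Pl → ℝ} (hf : Aff f) {a b x : Pl} (hx : x ∈ segment ℝ a b) :
    ∃ t : ℝ, 0 ≤ t ∧ t ≤ 1 ∧ x = a + t • (b - a) ∧ f x = (1 - t) * f a + t * f b := by
  rw [segment_eq_image'] at hx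
  obtain ⟨t, ht, rfl⟩ := hx
  exact ⟨t, ht.1, ht.2, rfl, by rw [hf]; ring⟩

/-- A one-parameter family of lines, each meeting the big part of `M` in exactly two points. -/
lemma family {M S : Set Pl} (H : Third M) (hS : S ⊆ M) (hfin : (M \ S).Finite)
    {f h : Pl → ℝ} (hf : Aff f) (hh : Aff h) {δ : ℝ} (hδ : 0 < δ)
    (hz : ∀ x ∈ M \ S, f x = 0 → h x = 0 → False)
    (hy : ∀ ε, 0 < ε → ε < δ → ∃ y₁ ∈ S, ∃ y₂ ∈ S, y₁ ≠ y₂ ∧ f y₁ + ε * h y₁ = 0 ∧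
      f y₂ + ε * h y₂ = 0 ∧ ∀ x ∈ S, f x + ε * h x = 0 → x = y₁ ∨ x = y₂) : False := by
  have key : ∀ ε ∈ Set.Ioo 0 δ, ∃ r ∈ M \ S, f r + ε * h r = 0 := by
    rintro ε ⟨h0, h1⟩
    obtain ⟨y₁, m1, y₂, m2, hne, e1, e2, hu⟩ := hy ε h0 h1
    obtain ⟨r, hr, n1, n2, t, ht⟩ := H y₁ (hS m1) y₂ (hS m2) hne
    have hr0 : f r + ε * h r = 0 := by
      rw [ht, hf, hh]; linear_combination (1 - t) * e1 + t * e2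
    refine ⟨r, ⟨hr, fun hrS => ?_⟩, hr0⟩
    rcases hu r hrS hr0 with h | h
    · exact n1 h
    · exact n2 h
  choose! r hr hr0 using key
  refine Set.infinite_of_injOn_mapsTo (f := r) ?_ hr (Set.Ioo_infinite hδ) hfin
  intro ε hε ε' hε' heq
  by_contra hne
  have e1 := hr0 ε hε
  have e2 := hr0 ε' hε'
  rw [← heq] at e2
  have : (ε - ε') * h (r ε) = 0 := by linear_combination e1 - e2
  rcases mul_eq_zero.1 this with h1 | h1
  · exact hne (sub_eq_zero.1 h1)
  · refine hz _ (hr ε hε) ?_ h1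
    rw [h1] at e1; simpa using e1

/-- Sylvester-Gallai for finite sets. -/
lemma finite_case {M : Set Pl} (H : Third M) (hfin : M.Finite) :
    ∀ p ∈ M, ∀ q ∈ M, ∀ r ∈ M, cr p q r = 0 := by
  by_contra hcon
  push Not at hcon
  obtain ⟨p₀, hp₀, q₀, hq₀, r₀, hr₀, h₀⟩ := hcon
  let N : Pl → Pl → ℝ := fun a b => (a 0 - b 0) ^ 2 + (a 1 - b 1) ^ 2
  let T : Set (Pl × Pl × Pl) := {x | x ∈ M ×ˢ M ×ˢ M ∧ cr x.1 x.2.1 x.2.2 ≠ 0}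
  have hT : T.Finite := (hfin.prod (hfin.prod hfin)).subset (fun x hx => hx.1)
  obtain ⟨⟨p, a, b⟩, ⟨⟨hp, ha, hb⟩, hc⟩, hmin⟩ :=
    Set.exists_min_image T (fun x => cr x.1 x.2.1 x.2.2 ^ 2 / N x.2.1 x.2.2) hT
      ⟨(p₀, q₀, r₀), ⟨⟨hp₀, hq₀, hr₀⟩, h₀⟩⟩
  try simp only at hp ha hb hc hmin
  have Npos : ∀ x y : Pl, x ≠ y → 0 < N x y := by
    intro x y hxy
    have : 0 ≤ N x y := by positivity
    refine lt_of_le_of_ne this (fun h => hxy ?_)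
    have h1 : (x 0 - y 0) ^ 2 = 0 := by
      have := sq_nonneg (x 0 - y 0); have := sq_nonneg (x 1 - y 1); simp only [N] at h; linarith
    have h2 : (x 1 - y 1) ^ 2 = 0 := by
      have := sq_nonneg (x 0 - y 0); have := sq_nonneg (x 1 - y 1); simp only [N] at h; linarith
    exact pl_ext (sub_eq_zero.1 (by simpa using h1)) (sub_eq_zero.1 (by simpa using h2))
  have hab : a ≠ b := by rintro rfl; apply hc; simp only [cr]; ring
  obtain ⟨c, hcM, hca, hcb, t, ht⟩ := H a ha b hb hab
  -- every point of the line is `a + s (b - a)`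
  have main : ∀ s u : ℝ, s ≠ u → a + s • (b - a) ∈ M → a + u • (b - a) ∈ M →
      N p (a + s • (b - a)) ≤ (s - u) ^ 2 * N a b := by
    intro s u hsu hs hu
    have hcr : cr (a + u • (b - a)) p (a + s • (b - a)) = (u - s) * cr p a b := by
      simp [cr]; ring
    have hne : (u - s) * cr p a b ≠ 0 := mul_ne_zero (sub_ne_zero.2 hsu.symm) hc
    have hps : p ≠ a + s • (b - a) := by
      intro h
      apply hne; rw [← hcr, ← h]; simp only [cr]; ring
    have h1 := hmin (a + u • (b - a), p, a + s • (b - a)) ⟨⟨hu, hp, hs⟩, by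
      simp only; rw [hcr]; exact hne⟩
    try simp only at h1
    rw [hcr, div_le_div_iff₀ (Npos _ _ hab) (Npos _ _ hps)] at h1
    have h2 : 0 < cr p a b ^ 2 := by positivity
    have h3 : cr p a b ^ 2 * N p (a + s • (b - a)) ≤
      cr p a b ^ 2 * ((s - u) ^ 2 * N a b) := by nlinarith
    exact le_of_mul_le_mul_left h3 h2
  have tri : ∀ s u v : ℝ, s < u → u < v → a + s • (b - a) ∈ M → a + u • (b - a) ∈ M →
      a + v • (b - a) ∈ M → False := by
    intro s u v hsu huv hs hu hv
    have h1 := main s u hsu.ne hs hu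
    have h2 := main v u huv.ne' hv hu
    have hpu : p ≠ a + u • (b - a) := by
      intro h; apply hc; rw [h]; simp [cr]; ring
    have h3 := Npos _ _ hpu
    simp only [N] at h1 h2 h3
    simp at h1 h2 h3
    have e1 : 0 < v - u := by linarith
    have e2 : 0 < u - s := by linarith
    have k1 := mul_le_mul_of_nonneg_left h1 e1.le
    have k2 := mul_le_mul_of_nonneg_left h2 e2.le
    have k3 := mul_pos (add_pos e1 e2) h3
    nlinarith
  have ma : a + (0:ℝ) • (b - a) ∈ M := by simpa using ha
  have mb : a + (1:ℝ) • (b - a) ∈ M := by simpa using hb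
  rw [ht] at hcM
  have t0 : t ≠ 0 := by rintro rfl; apply hca; simpa using ht
  have t1 : t ≠ 1 := by rintro rfl; apply hcb; simpa using ht
  rcases lt_or_gt_of_ne t0 with h | h
  · exact tri t 0 1 h one_pos hcM ma mb
  · rcases lt_or_gt_of_ne t1 with h' | h'
    · exact tri 0 t 1 h h' ma hcM mb
    · exact tri 0 1 t one_pos h' ma mb hcM


/-- The union of the segments. -/
def U (F : Finset (Pl × Pl)) : Set Pl := ⋃ s ∈ F, segment ℝ s.1 s.2

open Classical in
/-- The set of endpoints. -/
noncomputable def V (F : Finset (Pl × Pl)) : Finset Pl := F.image Prod.fst ∪ F.image Prod.snd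

lemma mem_U {F : Finset (Pl × Pl)} {x : Pl} :
    x ∈ U F ↔ ∃ s ∈ F, x ∈ segment ℝ s.1 s.2 := by
  simp [U]

lemma fst_mem_V {F : Finset (Pl × Pl)} {s : Pl × Pl} (hs : s ∈ F) : s.1 ∈ V F := by
  classical
  exact Finset.mem_union_left _ (Finset.mem_image_of_mem _ hs)

lemma snd_mem_V {F : Finset (Pl × Pl)} {s : Pl × Pl} (hs : s ∈ F) : s.2 ∈ V F := by
  classical
  exact Finset.mem_union_right _ (Finset.mem_image_of_mem _ hs)

lemma mem_V {F : Finset (Pl × Pl)} {v : Pl} (hv : v ∈ V F) :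
    ∃ s ∈ F, s.1 = v ∨ s.2 = v := by
  classical
  rcases Finset.mem_union.1 hv with h | h
  · obtain ⟨s, hs, h⟩ := Finset.mem_image.1 h
    exact ⟨s, hs, Or.inl h⟩
  · obtain ⟨s, hs, h⟩ := Finset.mem_image.1 h
    exact ⟨s, hs, Or.inr h⟩

lemma V_sub_U {F : Finset (Pl × Pl)} {v : Pl} (hv : v ∈ V F) : v ∈ U F := by
  obtain ⟨s, hs, h | h⟩ := mem_V hv
  · exact mem_U.2 ⟨s, hs, h ▸ left_mem_segment ℝ _ _⟩
  · exact mem_U.2 ⟨s, hs, h ▸ right_mem_segment ℝ _ _⟩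

lemma other {F : Finset (Pl × Pl)} (hnd : ∀ s ∈ F, s.1 ≠ s.2) {s : Pl × Pl} (hs : s ∈ F) {v : Pl}
    (h : s.1 = v ∨ s.2 = v) : ∃ w ∈ V F, w ≠ v ∧ segment ℝ s.1 s.2 = segment ℝ v w ∧
      openSegment ℝ s.1 s.2 = openSegment ℝ v w := by
  rcases h with rfl | rfl
  · exact ⟨s.2, snd_mem_V hs, (hnd s hs).symm, rfl, rfl⟩
  · exact ⟨s.1, fst_mem_V hs, hnd s hs, segment_symm _ _ _, openSegment_symm _ _ _⟩

lemma small (W : Finset Pl) (f h : Pl → ℝ) :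
    ∃ δ : ℝ, 0 < δ ∧ ∀ u ∈ W, 0 < f u → ∀ ε, 0 < ε → ε < δ → 0 < f u + ε * h u := by
  classical
  induction W using Finset.induction_on with
  | empty => exact ⟨1, one_pos, by simp⟩
  | insert a W _ ih =>
    obtain ⟨δ, hδ, H⟩ := ih
    by_cases ha : 0 < f a
    · refine ⟨min δ (f a / (|h a| + 1)), lt_min hδ (by positivity), ?_⟩
      intro u hu hfu ε h0 h1
      rcases Finset.mem_insert.1 hu with rfl | hu
      · have h2 := lt_of_lt_of_le h1 (min_le_right _ _)
        rw [lt_div_iff₀ (by positivity)] at h2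
        have h3 := neg_abs_le (h u)
        nlinarith
      · exact H u hu hfu ε h0 (lt_of_lt_of_le h1 (min_le_left _ _))
    · refine ⟨δ, hδ, ?_⟩
      intro u hu hfu ε h0 h1
      rcases Finset.mem_insert.1 hu with rfl | hu
      · exact absurd hfu ha
      · exact H u hu hfu ε h0 h1

lemma aff_clm (L : StrongDual ℝ Pl) (c : ℝ) : Aff (fun x => L x - c) := by
  intro x y t; simp; ring

lemma deg2 {F : Finset (Pl × Pl)} (hnd : ∀ s ∈ F, s.1 ≠ s.2)
    (hdisj : (F : Set (Pl × Pl)).Pairwise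
      fun s t => Disjoint (openSegment ℝ s.1 s.2) (openSegment ℝ t.1 t.2))
    {M : Set Pl} (hsub : U F ⊆ M) (hfin : (M \ U F).Finite) (H : Third M)
    {v : Pl} (L : StrongDual ℝ Pl) (hL : ∀ u ∈ V F, u ≠ v → L v < L u)
    {s t : Pl × Pl} (hs : s ∈ F) (ht : t ∈ F) (hst : s ≠ t) (hsv : s.1 = v ∨ s.2 = v)
    (htv : t.1 = v ∨ t.2 = v) (honly : ∀ r ∈ F, (r.1 = v ∨ r.2 = v) → r = s ∨ r = t) : False := by
  obtain ⟨δ, hδ, hsm⟩ := small (V F) (fun x => L x - L v) (fun _ => -1)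
  have hf := aff_clm L (L v)
  refine family H hsub hfin hf (h := fun _ => -1) (by intro x y t; simp) hδ
    (by intro x _ _ h; norm_num at h) ?_
  intro ε h0 h1
  have one : ∀ r ∈ F, (r.1 = v ∨ r.2 = v) → ∃ y ∈ openSegment ℝ r.1 r.2,
      L y - L v + ε * (-1) = 0 ∧
      ∀ x ∈ segment ℝ r.1 r.2, L x - L v + ε * (-1) = 0 → x = y := by
    intro r hr hrv
    obtain ⟨w, hw, hwv, hseg, hop⟩ := other hnd hr hrv
    rw [hseg, hop]
    have hpos : 0 < L w - L v := sub_pos.2 (hL w hw hwv)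
    have hlt := hsm w hw hpos ε h0 h1
    try simp only at hlt
    refine ⟨v + (ε / (L w - L v)) • (w - v), ?_, ?_, ?_⟩
    · rw [openSegment_eq_image']
      refine ⟨_, ⟨by positivity, ?_⟩, rfl⟩
      rw [div_lt_one hpos]; linarith
    · have := hf v w (ε / (L w - L v))
      try simp only at this
      rw [this]; field_simp; ring
    · intro x hx hx0
      obtain ⟨θ, _, _, hxe, hfx⟩ := hf.seg hx
      try simp only at hfx
      have : θ = ε / (L w - L v) := by
        rw [eq_div_iff hpos.ne']; linarith
      rw [hxe, this]
  obtain ⟨y₁, m1, e1, u1⟩ := one s hs hsv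
  obtain ⟨y₂, m2, e2, u2⟩ := one t ht htv
  refine ⟨y₁, mem_U.2 ⟨s, hs, openSegment_subset_segment _ _ _ m1⟩, y₂,
    mem_U.2 ⟨t, ht, openSegment_subset_segment _ _ _ m2⟩, ?_, e1, e2, ?_⟩
  · rintro rfl
    exact Set.disjoint_left.1 (hdisj hs ht hst) m1 m2
  · intro x hx hx0
    obtain ⟨r, hr, hxr⟩ := mem_U.1 hx
    by_cases hrv : r.1 = v ∨ r.2 = v
    · rcases honly r hr hrv with rfl | rfl
      · exact Or.inl (u1 x hxr hx0)
      · exact Or.inr (u2 x hxr hx0)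
    · exfalso
      push Not at hrv
      obtain ⟨θ, g0, g1, _, hfx⟩ := hf.seg hxr
      have k1 := hsm r.1 (fst_mem_V hr) (sub_pos.2 (hL _ (fst_mem_V hr) hrv.1)) ε h0 h1
      have k2 := hsm r.2 (snd_mem_V hr) (sub_pos.2 (hL _ (snd_mem_V hr) hrv.2)) ε h0 h1
      try simp only at hfx k1 k2
      rcases g0.eq_or_lt with h | h
      · subst h; linarith
      · have := mul_pos h k2
        have := mul_nonneg (sub_nonneg.2 g1) k1.le
        nlinarith

lemma deg1 {F : Finset (Pl × Pl)} (hnd : ∀ s ∈ F, s.1 ≠ s.2)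
    {M : Set Pl} (hsub : U F ⊆ M) (hfin : (M \ U F).Finite) (H : Third M)
    (hnc : ∀ a b, a ≠ b → ∃ u ∈ V F, cr a b u ≠ 0)
    {v : Pl} (L : StrongDual ℝ Pl) (hL : ∀ u ∈ V F, u ≠ v → L v < L u)
    {s : Pl × Pl} (hs : s ∈ F) (hsv : s.1 = v ∨ s.2 = v)
    (honly : ∀ r ∈ F, (r.1 = v ∨ r.2 = v) → r = s) : False := by
  classical
  obtain ⟨w, hw, hwv, hseg, hop⟩ := other hnd hs hsv
  obtain ⟨σ, hσ, u₀, hu₀, hku₀⟩ : ∃ σ : ℝ, σ ≠ 0 ∧ ∃ u ∈ V F, 0 < σ * cr v w u := by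
    obtain ⟨u, hu, hne⟩ := hnc v w hwv.symm
    exact ⟨cr v w u, hne, u, hu, mul_self_pos.2 hne⟩
  set k : Pl → ℝ := fun x => σ * cr v w x with hk
  have kv : k v = 0 := by simp [hk, cr]
  have kw : k w = 0 := by simp only [hk, cr]; ring
  have hu₀v : u₀ ≠ v := by rintro rfl; exact absurd kv hku₀.ne'
  set ℓ : Pl → ℝ := fun x => L x - L v with hℓ
  have ℓv : ℓ v = 0 := by simp [hℓ]
  have ℓpos : ∀ u ∈ V F, u ≠ v → 0 < ℓ u := fun u hu huv => sub_pos.2 (hL u hu huv)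
  obtain ⟨x₁, hx₁, hmax⟩ := Finset.exists_max_image ((V F).filter (· ≠ v)) (fun u => k u / ℓ u)
    ⟨u₀, Finset.mem_filter.2 ⟨hu₀, hu₀v⟩⟩
  obtain ⟨hx₁V, hx₁v⟩ := Finset.mem_filter.1 hx₁
  set μ := k x₁ / ℓ x₁ with hμ
  have μpos : 0 < μ := lt_of_lt_of_le (div_pos hku₀ (ℓpos u₀ hu₀ hu₀v))
    (hmax u₀ (Finset.mem_filter.2 ⟨hu₀, hu₀v⟩))
  have hle : ∀ u ∈ V F, u ≠ v → k u ≤ μ * ℓ u := by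
    intro u hu huv
    exact (div_le_iff₀ (ℓpos u hu huv)).1 (hmax u (Finset.mem_filter.2 ⟨hu, huv⟩))
  obtain ⟨x, hx, hmin⟩ := Finset.exists_min_image
    ((V F).filter (fun u => u ≠ v ∧ k u = μ * ℓ u)) ℓ
    ⟨x₁, Finset.mem_filter.2 ⟨hx₁V, hx₁v, by
      rw [hμ, div_mul_cancel₀ _ (ℓpos x₁ hx₁V hx₁v).ne']⟩⟩
  obtain ⟨hxV, hxv, hxk⟩ := Finset.mem_filter.1 hx
  have ℓx := ℓpos x hxV hxv
  have ℓw := ℓpos w hw hwv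
  -- the coordinates `(ℓ, k)` are injective
  have inj : ∀ z, ℓ z = ℓ x → k z = k x → z = x := by
    intro z h1 h2
    have h3 : (w - v) 0 * (z - x) 1 - (w - v) 1 * (z - x) 0 = 0 := by
      have : cr v w z = cr v w x := mul_left_cancel₀ hσ h2
      simp only [cr] at this
      simp; linarith
    obtain ⟨t, ht⟩ := par (sub_ne_zero.2 hwv) h3
    have h4 : t * ℓ w = 0 := by
      have := congrArg L ht
      simp only [map_sub, map_smul, smul_eq_mul] at this
      simp only [hℓ] at h1 ⊢
      linarith
    have h5 : t = 0 := (mul_eq_zero.1 h4).resolve_right ℓw.ne'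
    rw [h5, zero_smul] at ht
    exact sub_eq_zero.1 ht
  have aℓ : Aff ℓ := aff_clm L (L v)
  have ak : Aff k := by
    intro a b t
    have := aff_cr v w a b t
    simp only [hk] at this ⊢
    rw [this]; ring
  have af : Aff (fun u => μ * ℓ u - k u) := by
    intro a b t; simp only; rw [aℓ, ak]; ring
  have ah : Aff (fun u => ℓ u - ℓ x) := by
    intro a b t; simp only; rw [aℓ]; ring
  obtain ⟨δ, hδ, hsm⟩ := small (V F) (fun u => μ * ℓ u - k u) (fun u => ℓ u - ℓ x)
  refine family H hsub hfin af ah hδ ?_ ?_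
  · intro z hz h1 h2
    have h3 : ℓ z = ℓ x := by linarith
    have : z = x := inj z h3 (by rw [hxk, ← h3]; linarith)
    exact hz.2 (this ▸ V_sub_U hxV)
  intro ε h0 h1
  set g : Pl → ℝ := fun u => μ * ℓ u - k u + ε * (ℓ u - ℓ x) with hg
  have ag : Aff g := by
    intro a b t; simp only [hg]; rw [aℓ, ak]; ring
  have gv : g v < 0 := by
    simp only [hg, kv, ℓv]
    have := mul_pos h0 ℓx
    linarith
  have gx : g x = 0 := by simp only [hg]; rw [hxk]; ring
  have gpos : ∀ u ∈ V F, u ≠ v → u ≠ x → 0 < g u := by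
    intro u hu huv hux
    rcases (hle u hu huv).eq_or_lt with h | h
    · have h2 := hmin u (Finset.mem_filter.2 ⟨hu, huv, h⟩)
      have h3 : ℓ x ≠ ℓ u := fun h4 => hux (inj u h4.symm (by rw [h, hxk, h4]))
      have h4 : 0 < ℓ u - ℓ x := sub_pos.2 (lt_of_le_of_ne h2 h3)
      have := mul_pos h0 h4
      simp only [hg]; linarith
    · exact hsm u hu (sub_pos.2 h) ε h0 h1
  have gnn : ∀ u ∈ V F, u ≠ v → 0 ≤ g u := by
    intro u hu huv
    by_cases hux : u = x
    · rw [hux, gx]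
    · exact (gpos u hu huv hux).le
  have hwx : w ≠ x := by
    rintro rfl
    rw [kw] at hxk
    exact absurd hxk (mul_pos μpos ℓw).ne
  have gw := gpos w hw hwv hwx
  have gd : 0 < g w - g v := by linarith
  have θpos : 0 < -g v / (g w - g v) := div_pos (by linarith) gd
  set θ := -g v / (g w - g v) with hθ
  have θ1 : θ < 1 := by rw [hθ, div_lt_one gd]; linarith
  refine ⟨x, V_sub_U hxV, v + θ • (w - v), mem_U.2 ⟨s, hs, ?_⟩, ?_, gx, ?_, ?_⟩
  · rw [hseg, segment_eq_image']
    exact ⟨θ, ⟨θpos.le, θ1.le⟩, rfl⟩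
  · intro h
    have h2 := af v w θ
    try simp only at h2
    rw [← h, kv, kw, ℓv, hxk] at h2
    have := mul_pos θpos (mul_pos μpos ℓw)
    linarith
  · have h2 := ag v w θ
    have h3 : θ * (g w - g v) = -g v := by rw [hθ, div_mul_cancel₀ _ gd.ne']
    rw [h3] at h2
    simp only [hg] at h2 ⊢
    linarith
  · intro z hz hz0
    have hz0 : g z = 0 := hz0
    obtain ⟨r, hr, hzr⟩ := mem_U.1 hz
    by_cases hrv : r.1 = v ∨ r.2 = v
    · right
      rw [honly r hr hrv, hseg] at hzr
      obtain ⟨τ, _, _, hze, hgz⟩ := ag.seg hzr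
      have : τ = θ := by rw [hθ, eq_div_iff gd.ne']; linarith
      rw [hze, this]
    · left
      push Not at hrv
      obtain ⟨τ, t0, t1, hze, hgz⟩ := ag.seg hzr
      have n1 := gnn r.1 (fst_mem_V hr) hrv.1
      have n2 := gnn r.2 (snd_mem_V hr) hrv.2
      have m1 := mul_nonneg (sub_nonneg.2 t1) n1
      have m2 := mul_nonneg t0 n2
      have z1 : (1 - τ) * g r.1 = 0 := by linarith
      have z2 : τ * g r.2 = 0 := by linarith
      have c1 : g r.1 = 0 → r.1 = x := fun h => by
        by_contra hne
        exact absurd h (gpos _ (fst_mem_V hr) hrv.1 hne).ne'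
      have c2 : g r.2 = 0 → r.2 = x := fun h => by
        by_contra hne
        exact absurd h (gpos _ (snd_mem_V hr) hrv.2 hne).ne'
      rcases mul_eq_zero.1 z1 with h | h
      · have : τ = 1 := by linarith
        subst this
        rw [hze, one_smul, add_sub_cancel]
        exact c2 (by simpa using z2)
      · rcases mul_eq_zero.1 z2 with h' | h'
        · rw [hze, h', zero_smul, add_zero]; exact c1 h
        · exact absurd ((c1 h).trans (c2 h').symm) (hnd r hr)

/-- Every exposed endpoint has degree at least three. -/
lemma deg3 {F : Finset (Pl × Pl)} (hnd : ∀ s ∈ F, s.1 ≠ s.2)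
    (hdisj : (F : Set (Pl × Pl)).Pairwise
      fun s t => Disjoint (openSegment ℝ s.1 s.2) (openSegment ℝ t.1 t.2))
    {M : Set Pl} (hsub : U F ⊆ M) (hfin : (M \ U F).Finite) (H : Third M)
    (hnc : ∀ a b, a ≠ b → ∃ u ∈ V F, cr a b u ≠ 0)
    {v : Pl} (hv : v ∈ V F) (L : StrongDual ℝ Pl) (hL : ∀ u ∈ V F, u ≠ v → L v < L u)
    (D : Finset (Pl × Pl)) (hD : ∀ r, r ∈ D ↔ r ∈ F ∧ (r.1 = v ∨ r.2 = v)) : 3 ≤ D.card := by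
  by_contra hlt
  obtain ⟨s, hs, hsv⟩ := mem_V hv
  have hsD : s ∈ D := (hD s).2 ⟨hs, hsv⟩
  by_cases h : ∃ t ∈ D, t ≠ s
  · obtain ⟨t, htD, hts⟩ := h
    obtain ⟨ht, htv⟩ := (hD t).1 htD
    refine deg2 hnd hdisj hsub hfin H L hL hs ht hts.symm hsv htv ?_
    intro r hr hrv
    by_contra hcon
    push Not at hcon
    apply hlt
    exact Finset.two_lt_card.2 ⟨s, hsD, t, htD, r, (hD r).2 ⟨hr, hrv⟩, hts.symm,
      hcon.1.symm, hcon.2.symm⟩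
  · push Not at h
    exact deg1 hnd hsub hfin H hnc L hL hs hsv (fun r hr hrv => h r ((hD r).2 ⟨hr, hrv⟩))

/-- Three exposed points. -/
lemma exposed (W : Finset Pl) (hne : W.Nonempty)
    (hnc : ∀ a b, ∃ u ∈ W, u ∉ segment ℝ a b) :
    ∃ v₁ ∈ W, ∃ v₂ ∈ W, ∃ v₃ ∈ W, v₁ ≠ v₂ ∧ v₁ ≠ v₃ ∧ v₂ ≠ v₃ ∧
      ∀ v, (v = v₁ ∨ v = v₂ ∨ v = v₃) → ∃ L : StrongDual ℝ Pl, ∀ u ∈ W, u ≠ v → L v < L u := by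
  set E := (convexHull ℝ (W : Set Pl)).extremePoints ℝ with hE
  have hEW : E ⊆ W := extremePoints_convexHull_subset
  have hEfin : E.Finite := W.finite_toSet.subset hEW
  have hKM : convexHull ℝ E = convexHull ℝ (W : Set Pl) := by
    rw [← hEfin.isClosed_convexHull (𝕜 := ℝ) |>.closure_eq]
    exact closure_convexHull_extremePoints (W.finite_toSet.isCompact_convexHull (𝕜 := ℝ))
      (convex_convexHull ℝ _)
  have hEsub : ∀ a b, ¬ E ⊆ {a, b} := by
    intro a b h
    obtain ⟨u, hu, hus⟩ := hnc a b
    apply hus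
    rw [← convexHull_pair]
    apply convexHull_mono h
    rw [hKM]
    exact subset_convexHull ℝ _ hu
  have hexp : ∀ v ∈ E, ∃ L : StrongDual ℝ Pl, ∀ u ∈ W, u ≠ v → L v < L u := by
    intro v hv
    rw [hE, (convex_convexHull ℝ _).mem_extremePoints_iff_mem_sdiff_convexHull_sdiff] at hv
    have hv' : v ∉ convexHull ℝ ((W : Set Pl) \ {v}) := fun h => hv.2
      (convexHull_mono (Set.sdiff_subset_sdiff_left (subset_convexHull ℝ _)) h)
    obtain ⟨L, c, h1, h2⟩ := geometric_hahn_banach_point_closed (convex_convexHull ℝ _)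
      ((W.finite_toSet.subset Set.sdiff_subset).isClosed_convexHull (𝕜 := ℝ)) hv'
    refine ⟨L, fun u hu huv => ?_⟩
    exact lt_trans h1 (h2 u (subset_convexHull ℝ _ ⟨hu, huv⟩))
  obtain ⟨a, ha, -⟩ := Set.not_subset.1 (hEsub 0 0)
  obtain ⟨b, hb, hab⟩ := Set.not_subset.1 (hEsub a a)
  obtain ⟨c, hc, hcab⟩ := Set.not_subset.1 (hEsub a b)
  simp at hab hcab
  refine ⟨a, hEW ha, b, hEW hb, c, hEW hc, fun h => hab h.symm, fun h => hcab.1 h.symm,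
    fun h => hcab.2 h.symm, ?_⟩
  rintro v (rfl | rfl | rfl)
  · exact hexp _ ha
  · exact hexp _ hb
  · exact hexp _ hc

lemma pair_unique {F : Finset (Pl × Pl)}
    (hdisj : (F : Set (Pl × Pl)).Pairwise
      fun s t => Disjoint (openSegment ℝ s.1 s.2) (openSegment ℝ t.1 t.2))
    {a b : Pl} (hab : a ≠ b) (D : Finset (Pl × Pl))
    (hD : ∀ r ∈ D, r ∈ F ∧ (r.1 = a ∨ r.2 = a) ∧ (r.1 = b ∨ r.2 = b)) : D.card ≤ 1 := by
  rw [Finset.card_le_one]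
  have key : ∀ r ∈ D, openSegment ℝ r.1 r.2 = openSegment ℝ a b := by
    intro r hr
    obtain ⟨_, h1 | h1, h2 | h2⟩ := hD r hr
    · exact absurd (h1.symm.trans h2) hab
    · rw [h1, h2]
    · rw [h1, h2, openSegment_symm]
    · exact absurd (h1.symm.trans h2) hab
  intro s hs t ht
  by_contra hne
  have this : Disjoint (openSegment ℝ s.1 s.2) (openSegment ℝ t.1 t.2) :=
    hdisj (hD s hs).1 (hD t ht).1 hne
  rw [key s hs, key t ht, disjoint_self] at this
  have hm : midpoint ℝ a b ∈ openSegment ℝ a b := midpoint_mem_openSegment a b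
  rw [this] at hm
  exact hm

/-- The case of non-collinear segments. -/
lemma noncollinear_case {F : Finset (Pl × Pl)} (hcard : F.card ≤ 5) (hnd : ∀ s ∈ F, s.1 ≠ s.2)
    (hdisj : (F : Set (Pl × Pl)).Pairwise
      fun s t => Disjoint (openSegment ℝ s.1 s.2) (openSegment ℝ t.1 t.2))
    {M : Set Pl} (hsub : U F ⊆ M) (hfin : (M \ U F).Finite) (H : Third M)
    {p q r : Pl} (hp : p ∈ V F) (hq : q ∈ V F) (hr : r ∈ V F) (hpqr : cr p q r ≠ 0) : False := by
  classical
  have hline : ∀ a b : Pl, ¬ ∀ u ∈ V F, ∃ t : ℝ, u = a + t • (b - a) := by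
    intro a b h
    obtain ⟨t₁, h₁⟩ := h p hp
    obtain ⟨t₂, h₂⟩ := h q hq
    obtain ⟨t₃, h₃⟩ := h r hr
    apply hpqr
    rw [h₁, h₂, h₃]
    simp [cr]; ring
  have hnc : ∀ a b, a ≠ b → ∃ u ∈ V F, cr a b u ≠ 0 := by
    intro a b hab
    by_contra hcon
    push Not at hcon
    exact hline a b (fun u hu => par' hab (hcon u hu))
  obtain ⟨v₁, h₁, v₂, h₂, v₃, h₃, h12, h13, h23, hexp⟩ := exposed (V F) ⟨p, hp⟩ (by
    intro a b
    by_contra hcon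
    push Not at hcon
    refine hline a b (fun u hu => ?_)
    have := hcon u hu
    rw [segment_eq_image'] at this
    obtain ⟨t, _, ht⟩ := this
    exact ⟨t, ht.symm⟩)
  let D : Pl → Finset (Pl × Pl) := fun v => F.filter (fun r => r.1 = v ∨ r.2 = v)
  have hD : ∀ v r, r ∈ D v ↔ r ∈ F ∧ (r.1 = v ∨ r.2 = v) := by intro v r; simp [D]
  have d3 : ∀ v ∈ V F, (v = v₁ ∨ v = v₂ ∨ v = v₃) → 3 ≤ (D v).card := by
    intro v hv h
    obtain ⟨L, hL⟩ := hexp v h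
    exact deg3 hnd hdisj hsub hfin H hnc hv L hL (D v) (hD v)
  have c1 := d3 v₁ h₁ (by simp)
  have c2 := d3 v₂ h₂ (by simp)
  have c3 := d3 v₃ h₃ (by simp)
  have pu : ∀ a b, a ≠ b → (D a ∩ D b).card ≤ 1 := by
    intro a b hab
    refine pair_unique hdisj hab _ (fun r hr => ?_)
    obtain ⟨m1, m2⟩ := Finset.mem_inter.1 hr
    exact ⟨((hD a r).1 m1).1, ((hD a r).1 m1).2, ((hD b r).1 m2).2⟩
  have i12 := pu v₁ v₂ h12
  have i13 := pu v₁ v₃ h13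
  have i23 := pu v₂ v₃ h23
  have e1 := Finset.card_union_add_card_inter (D v₁) (D v₂)
  have e2 := Finset.card_union_add_card_inter (D v₁ ∪ D v₂) (D v₃)
  have e3 : ((D v₁ ∪ D v₂) ∩ D v₃).card ≤ (D v₁ ∩ D v₃).card + (D v₂ ∩ D v₃).card := by
    rw [Finset.union_inter_distrib_right]
    exact Finset.card_union_le _ _
  have e4 : (D v₁ ∪ D v₂ ∪ D v₃).card ≤ F.card := by
    apply Finset.card_le_card
    intro r hr
    simp only [Finset.mem_union, hD] at hr
    tauto
  omega

/-- The case of collinear segments. -/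
lemma collinear_case {F : Finset (Pl × Pl)} (hnd : ∀ s ∈ F, s.1 ≠ s.2)
    {M : Set Pl} (hsub : U F ⊆ M) (hfin : (M \ U F).Finite) (H : Third M)
    {s : Pl × Pl} (hs : s ∈ F) (hcol : ∀ u ∈ V F, cr s.1 s.2 u = 0) :
    ∀ p ∈ M, cr s.1 s.2 p = 0 := by
  intro p hp
  by_contra hne
  obtain ⟨a, b⟩ := s
  try simp only at hcol hne
  have hab : a ≠ b := hnd _ hs
  have aff := aff_cr a b
  have hU : ∀ x ∈ U F, cr a b x = 0 := by
    intro x hx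
    obtain ⟨r, hr, hxr⟩ := mem_U.1 hx
    obtain ⟨t, _, _, _, h⟩ := aff.seg hxr
    try simp only at h
    rw [h, hcol _ (fst_mem_V hr), hcol _ (snd_mem_V hr)]; ring
  refine family (S := U F ∪ {p}) H (Set.union_subset hsub (by simpa using hp))
    (hfin.subset (Set.sdiff_subset_sdiff_right Set.subset_union_left)) (aff_cr p a)
    (h := fun x => cr p b x - cr p a x) ?_ one_pos ?_ ?_
  · intro x y t
    have h1 := aff_cr p a x y t
    have h2 := aff_cr p b x y t
    try simp only at h1 h2 ⊢
    rw [h1, h2]; ring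
  · intro x hx h1 h2
    have h2 : cr p b x = 0 := by linarith
    have hpa : p ≠ a := by
      rintro rfl; apply hne; simp [cr]
    obtain ⟨t, ht⟩ := par' hpa h1
    have h3 : t * cr a b p = 0 := by
      rw [ht] at h2
      rw [← neg_eq_zero, ← h2]; simp [cr]; ring
    have h4 : t = 0 := (mul_eq_zero.1 h3).resolve_right hne
    apply hx.2
    right
    rw [ht, h4]; simp
  · intro ε h0 h1
    have hyU : a + ε • (b - a) ∈ U F := by
      refine mem_U.2 ⟨(a, b), hs, ?_⟩
      rw [segment_eq_image']
      exact ⟨ε, ⟨h0.le, h1.le⟩, rfl⟩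
    refine ⟨a + ε • (b - a), Or.inl hyU, p, Or.inr rfl, ?_, ?_, ?_, ?_⟩
    · intro h
      exact hne (h ▸ hU _ hyU)
    · simp [cr]; ring
    · simp [cr]
    · rintro x (hx | hx) hx0
      · left
        obtain ⟨t, ht⟩ := par' hab (hU x hx)
        have h3 : (t - ε) * cr a b p = 0 := by
          rw [ht] at hx0
          rw [← hx0]; simp [cr]; ring
        have h4 : t = ε := sub_eq_zero.1 ((mul_eq_zero.1 h3).resolve_right hne)
        rw [ht, h4]
      · right; exact hx

end SegSG

theorem segments_sylvester_gallai
    (F : Finset (EuclideanSpace ℝ (Fin 2) × EuclideanSpace ℝ (Fin 2)))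
    (hcard : F.card ≤ 5)
    (hnd : ∀ s ∈ F, s.1 ≠ s.2)
    (hdisj : (F : Set (EuclideanSpace ℝ (Fin 2) × EuclideanSpace ℝ (Fin 2))).Pairwise
      fun s t => Disjoint (openSegment ℝ s.1 s.2) (openSegment ℝ t.1 t.2))
    (M : Set (EuclideanSpace ℝ (Fin 2)))
    (hsub : (⋃ s ∈ F, segment ℝ s.1 s.2) ⊆ M)
    (hfin : (M \ ⋃ s ∈ F, segment ℝ s.1 s.2).Finite)
    (hline : ∀ L : AffineSubspace ℝ (EuclideanSpace ℝ (Fin 2)), IsLine L →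
      ¬ ∃ p q, p ≠ q ∧ (L : Set (EuclideanSpace ℝ (Fin 2))) ∩ M = {p, q}) :
    Collinear ℝ M := by
  have H := SegSG.third_of_hline M hline
  apply SegSG.collinear_of_cr
  rcases F.eq_empty_or_nonempty with rfl | ⟨s, hs⟩
  · exact SegSG.finite_case H (by simpa using hfin)
  · have hcol : ∀ u ∈ SegSG.V F, SegSG.cr s.1 s.2 u = 0 := by
      intro u hu
      by_contra hne
      exact SegSG.noncollinear_case hcard hnd hdisj hsub hfin H (SegSG.fst_mem_V hs)
        (SegSG.snd_mem_V hs) hu hne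
    have hM := SegSG.collinear_case hnd hsub hfin H hs hcol
    intro p hp q hq r hr
    obtain ⟨t₁, h₁⟩ := SegSG.par' (hnd s hs) (hM p hp)
    obtain ⟨t₂, h₂⟩ := SegSG.par' (hnd s hs) (hM q hq)
    obtain ⟨t₃, h₃⟩ := SegSG.par' (hnd s hs) (hM r hr)
    rw [h₁, h₂, h₃]
    simp [SegSG.cr]; ring
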